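/- Let m ≥ 1, p = 3, p1 = 5, p2 = 7, N = 5^m·7, and q = 3^{12·5^{m−1}}. Then for every k with 0 ≤ k ≤ 34, the Cayley graph Cay(F_q, D_k) is a strongly regular graph of degree (q−1)/35, where D_k = ∪_{i=0}^{5^{m−1}−1} C_{7i + k·5^{m−1}}. -/

import Mathlib

open scoped Classical

noncomputable section

lemma FiniteField.sum_pow_mul_one_sub_pow {F : Type*} [Field F] [Fintype F]
    (hF : 2 < Fintype.card F) {a : ℕ} (ha : a < Fintype.card F) :
    ∑ x : F, x ^ a * (1 - x) ^ (Fintype.card F - 2) = a := by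
  set q := Fintype.card F with hq
  have key (x : F) : x ^ a * (1 - x) ^ (q - 2) =
      (1 - x) ^ (q - 2) - ∑ i ∈ Finset.range a, (x ^ i - if x = 1 then 1 else 0) := by
    have h1 : (1 - x) ^ (q - 1) = 1 - if x = 1 then 1 else 0 := by
      split_ifs with h
      · simp [h, show q - 1 ≠ 0 by omega]
      · rw [FiniteField.pow_card_sub_one_eq_one _ (sub_ne_zero.2 (Ne.symm h)), sub_zero]
    have h2 : ∑ i ∈ Finset.range a, (x ^ i - if x = 1 then (1 : F) else 0) =
        (1 - x) ^ (q - 1) * ∑ i ∈ Finset.range a, x ^ i := by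
      rw [h1, Finset.mul_sum]
      refine Finset.sum_congr rfl fun i _ ↦ ?_
      split_ifs with h <;> simp [h]
    rw [h2, show q - 1 = q - 2 + 1 by omega, pow_succ, mul_assoc, mul_neg_geom_sum]
    ring
  have h0 : ∑ x : F, (1 - x) ^ (q - 2) = 0 := by
    rw [← FiniteField.sum_pow_lt_card_sub_one (K := F) (q - 2) (by omega)]
    exact Fintype.sum_equiv (Equiv.subLeft 1) _ _ fun x ↦ rfl
  simp_rw [key]
  rw [Finset.sum_sub_distrib, h0, Finset.sum_comm]
  simp only [Finset.sum_sub_distrib, Finset.sum_ite_eq', Finset.mem_univ, if_true]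
  rw [Finset.sum_eq_zero fun i hi ↦
    FiniteField.sum_pow_lt_card_sub_one (K := F) i (by have := Finset.mem_range.1 hi; omega)]
  simp

section Stickelberger

variable (p : ℕ) [hp : Fact p.Prime] (F : Type*) [Field F] [Fintype F] [CharP F p]

/-- The inverse of the Teichmüller character of a finite field. -/
def invTeichmuller : MulChar F (WittVector p F) :=
  { WittVector.teichmuller p with
    map_nonunit' := fun a ha ↦ by
      obtain rfl : a = 0 := by simpa using ha
      exact WittVector.teichmuller_zero p : MulChar F (WittVector p F) }⁻¹

variable {F}

omit [Fintype F] [CharP F p] in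
lemma invTeichmuller_apply (x : F) : invTeichmuller p F x = WittVector.teichmuller p x⁻¹ := by
  rw [invTeichmuller, MulChar.inv_apply']
  rfl

omit [Fintype F] [CharP F p] in
lemma constantCoeff_invTeichmuller_pow (k : ℕ) {x : F} (hx : x ≠ 0) :
    WittVector.constantCoeff ((invTeichmuller p F ^ k) x) = (x⁻¹) ^ k := by
  have h := MulChar.pow_apply_coe (invTeichmuller p F) k (Units.mk0 x hx)
  rw [Units.val_mk0] at h
  rw [h, map_pow, invTeichmuller_apply]
  congr 1

lemma isUnit_jacobiSum_invTeichmuller (hF : 2 < Fintype.card F) {k : ℕ}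
    (hk : k < Fintype.card F - 1) (hk' : ¬ p ∣ k + 1) :
    IsUnit (jacobiSum (invTeichmuller p F ^ k) (invTeichmuller p F)) := by
  set q := Fintype.card F with hq
  apply WittVector.isUnit_of_coeff_zero_ne_zero
  have key : WittVector.constantCoeff (jacobiSum (invTeichmuller p F ^ k) (invTeichmuller p F)) =
      ((q - 1 - k : ℕ) : F) := by
    rw [← FiniteField.sum_pow_mul_one_sub_pow hF (by omega), jacobiSum, map_sum]
    refine Finset.sum_congr rfl fun x _ ↦ ?_
    rcases eq_or_ne x 0 with rfl | h0
    · rw [MulChar.map_zero]; simp [show q - 1 - k ≠ 0 by omega]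
    rcases eq_or_ne (1 - x) 0 with h1 | h1
    · rw [h1, MulChar.map_zero]; simp [← hq, show q - 2 ≠ 0 by omega]
    have e (y : F) (hy : y ≠ 0) (j : ℕ) (hj : j ≤ q - 1) : (y⁻¹) ^ j = y ^ (q - 1 - j) := by
      rw [inv_pow]
      refine inv_eq_of_mul_eq_one_right ?_
      rw [← pow_add, Nat.add_sub_cancel' hj, hq, FiniteField.pow_card_sub_one_eq_one y hy]
    rw [map_mul, constantCoeff_invTeichmuller_pow p k h0, ← pow_one (invTeichmuller p F),
      constantCoeff_invTeichmuller_pow p 1 h1, e x h0 k (by omega), e _ h1 1 (by omega), ← hq,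
      show q - 1 - 1 = q - 2 by omega]
  change WittVector.constantCoeff _ ≠ 0
  rw [key, Nat.cast_sub (by omega), Nat.cast_sub (by omega), FiniteField.cast_card_eq_zero]
  intro h
  refine hk' ((CharP.cast_eq_zero_iff F p _).1 ?_)
  push_cast at h ⊢
  linear_combination -h

variable (F) (R : Type*) [CommRing R] [Algebra (WittVector p F) R]

/-- The inverse of the Teichmüller character, with values in an algebra over the Witt vectors. -/
def invTeichmullerChar : MulChar F R :=
  (invTeichmuller p F).ringHomComp (algebraMap _ R)

variable {F} {R}

omit [Fintype F] [CharP F p] in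
lemma invTeichmullerChar_pow (k : ℕ) :
    invTeichmullerChar p F R ^ k = (invTeichmuller p F ^ k).ringHomComp (algebraMap _ R) :=
  (MulChar.ringHomComp_pow _ _ _)

omit [CharP F p] in
lemma invTeichmullerChar_pow_ne_one [FaithfulSMul (WittVector p F) R] {k : ℕ} (h0 : k ≠ 0)
    (hk : k < Fintype.card F - 1) : invTeichmullerChar p F R ^ k ≠ 1 := by
  intro h
  refine absurd (Nat.le_of_dvd (by omega) ((FiniteField.forall_pow_eq_one_iff F k).1 fun x ↦ ?_))
    (by omega)
  rw [invTeichmullerChar_pow] at h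
  have h1 : algebraMap _ R ((invTeichmuller p F ^ k) (x⁻¹ : Fˣ)) = 1 := by
    have := congrArg (fun χ : MulChar F R ↦ χ (x⁻¹ : Fˣ)) h
    rwa [MulChar.one_apply_coe] at this
  rw [← map_one (algebraMap (WittVector p F) R)] at h1
  have h2 := congrArg WittVector.constantCoeff (FaithfulSMul.algebraMap_injective _ R h1)
  rw [constantCoeff_invTeichmuller_pow p k (Units.ne_zero _), map_one] at h2
  ext
  simpa using h2

/-- The lower bound in Stickelberger's theorem: the Gauss sum of the `k`-th power of the inverse
Teichmüller character is divisible by the `s`-th power of the uniformizer, where `s` is the sum of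
the base `p` digits of `k`. -/
theorem pow_digits_sum_dvd_gaussSum [IsDomain R] [FaithfulSMul (WittVector p F) R]
    (hF : 2 < Fintype.card F) {ψ : AddChar F R} {ϖ : R} (hψ : ∀ x, ϖ ∣ ψ x - 1)
    (hψp : ∀ x, ψ (x ^ p) = ψ x) (k : ℕ) (hk : k < Fintype.card F - 1) :
    ϖ ^ (p.digits k).sum ∣ gaussSum (invTeichmullerChar p F R ^ k) ψ := by
  have hp1 := hp.out.one_lt
  set χ := invTeichmullerChar p F R with hχ
  have base : ϖ ∣ gaussSum χ ψ := by
    have h1 : gaussSum χ ψ = ∑ x, χ x * (ψ x - 1) := by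
      simp_rw [mul_sub, mul_one, Finset.sum_sub_distrib]
      rw [MulChar.sum_eq_zero_of_ne_one, sub_zero]; · rfl
      simpa using invTeichmullerChar_pow_ne_one (R := R) p one_ne_zero (show 1 < _ by omega)
    rw [h1]
    exact Finset.dvd_sum fun x _ ↦ (hψ x).mul_left _
  induction k using Nat.strong_induction_on with
  | _ k ih =>
    rcases Nat.eq_zero_or_pos k with rfl | h0
    · simp
    rw [Nat.digits_def' hp1 h0, List.sum_cons]
    by_cases hpk : p ∣ k
    · obtain ⟨j, rfl⟩ := hpk
      have hj : 0 < j := Nat.pos_of_mul_pos_left h0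
      have hlt : j < p * j := by nlinarith
      rw [Nat.mul_mod_right, zero_add, Nat.mul_div_cancel_left _ hp.out.pos]
      convert ih j hlt (hlt.trans hk) using 1
      symm
      rw [gaussSum, gaussSum, ← (frobeniusEquiv F p).bijective.sum_comp]
      refine Finset.sum_congr rfl fun x _ ↦ ?_
      have hx : frobeniusEquiv F p x = x ^ p := rfl
      rw [hx, hψp]
      rcases eq_or_ne x 0 with rfl | hx0
      · simp [hp.out.ne_zero, MulChar.map_zero]
      · have h1 := MulChar.pow_apply_coe χ j (Units.mk0 x hx0 ^ p)
        have h2 := MulChar.pow_apply_coe χ (p * j) (Units.mk0 x hx0)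
        rw [Units.val_pow_eq_pow_val, Units.val_mk0] at h1
        rw [Units.val_mk0] at h2
        rw [h1, h2, map_pow, ← pow_mul]
    · obtain ⟨j, rfl⟩ : ∃ j, k = j + 1 := ⟨k - 1, by omega⟩
      have hs : (j + 1) % p + (p.digits ((j + 1) / p)).sum = (p.digits j).sum + 1 := by
        have hlt : j % p + 1 < p := by
          have := Nat.mod_lt j hp.out.pos
          by_contra! hle
          exact hpk (Nat.dvd_of_mod_eq_zero (by
            rw [Nat.add_mod, Nat.mod_eq_of_lt hp1, show j % p + 1 = p by omega, Nat.mod_self]))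
        have h1 : (j + 1) % p = j % p + 1 := by
          rw [Nat.add_mod, Nat.mod_eq_of_lt hp1, Nat.mod_eq_of_lt hlt]
        have h2 : (j + 1) / p = j / p := by
          rw [Nat.succ_div, if_neg hpk, add_zero]
        rw [h1, h2]
        rcases Nat.eq_zero_or_pos j with rfl | hj
        · simp
        · rw [Nat.digits_def' hp1 hj, List.sum_cons]; ring
      rw [hs, pow_succ]
      have hJ := (isUnit_jacobiSum_invTeichmuller p hF (by omega : j < _) hpk).map
        (algebraMap _ R)
      rw [← jacobiSum_ringHomComp, ← invTeichmullerChar_pow] at hJ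
      have := jacobiSum_mul_nontrivial (χ := χ ^ j) (φ := χ)
        (by rw [← pow_succ]; exact invTeichmullerChar_pow_ne_one p (by omega) hk) ψ
      rw [← pow_succ] at this
      rw [← hJ.dvd_mul_right]
      erw [this]
      exact mul_dvd_mul (ih j (by omega) (by omega)) base

end Stickelberger

/-- The digit sum of `k` in base `p`, computed from the cyclic shifts of its `f` digits. -/
lemma Nat.sub_one_mul_sum_pow_mul_mod {p : ℕ} (hp : 1 < p) (f : ℕ) {k : ℕ} (hk : k < p ^ f - 1) :
    (p - 1) * ∑ i ∈ Finset.range f, (p ^ i * k % (p ^ f - 1)) =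
      (p ^ f - 1) * (p.digits k).sum := by
  have hmod (i : ℕ) (hi : i < f) :
      p ^ i * k % (p ^ f - 1) + (p ^ f - 1) * (k / p ^ (f - i)) = p ^ i * k := by
    have hpf : p ^ i * p ^ (f - i) = p ^ f := by rw [← pow_add, Nat.add_sub_cancel' hi.le]
    have hd := Nat.div_add_mod k (p ^ (f - i))
    set a := k % p ^ (f - i) with ha
    set b := k / p ^ (f - i) with hb
    have hpos : 0 < p ^ (f - i) := by positivity
    have ha' : a < p ^ (f - i) := Nat.mod_lt _ hpos
    have hb' : b < p ^ i := by
      rw [hb, Nat.div_lt_iff_lt_mul hpos, hpf]; omega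
    obtain ⟨Q, hQ⟩ : ∃ Q, p ^ f = Q + 1 := ⟨p ^ f - 1, by omega⟩
    rw [hQ] at hk hpf ⊢
    rw [Nat.add_sub_cancel] at hk ⊢
    have hlt : p ^ i * a + b < Q := by
      have h1 : p ^ i * a + b ≤ Q := by
        have : p ^ i * (a + 1) ≤ p ^ i * p ^ (f - i) := Nat.mul_le_mul_left _ ha'
        rw [hpf] at this
        nlinarith
      refine lt_of_le_of_ne h1 fun h ↦ ?_
      have ha1 : a + 1 = p ^ (f - i) := by
        by_contra hne
        have : p ^ i * (a + 1 + 1) ≤ p ^ i * p ^ (f - i) := Nat.mul_le_mul_left _ (by omega)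
        rw [hpf] at this
        nlinarith
      have hb1 : b + 1 = p ^ i := by
        have : p ^ i * (a + 1) = Q + 1 := by rw [ha1, hpf]
        nlinarith
      have : (a + 1) * (b + 1) = Q + 1 := by rw [ha1, hb1, mul_comm, hpf]
      nlinarith
    have he : p ^ i * k = p ^ i * a + b + Q * b := by
      rw [← hd]
      linear_combination b * hpf
    rw [he, Nat.add_mul_mod_self_left, Nat.mod_eq_of_lt hlt]
  have hdiv : (p - 1) * ∑ i ∈ Finset.range f, k / p ^ (f - i) + (p.digits k).sum = k := by
    have h1 : ∑ i ∈ Finset.range f, k / p ^ (f - i) = ∑ i ∈ Finset.range f, k / p ^ (i + 1) := by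
      rw [← Finset.sum_range_reflect]
      refine Finset.sum_congr rfl fun i hi ↦ ?_
      rw [show f - (f - 1 - i) = i + 1 by have := Finset.mem_range.1 hi; omega]
    have h2 : ∑ i ∈ Finset.range (Nat.log p k).succ, k / p ^ i.succ =
        ∑ i ∈ Finset.range f, k / p ^ (i + 1) := by
      have hf0 : f ≠ 0 := by rintro rfl; simp at hk
      refine Finset.sum_subset (Finset.range_subset_range.2
        (Nat.log_lt_of_lt_pow' hf0 (by omega))) fun i _ hi ↦ ?_
      refine Nat.div_eq_of_lt (Nat.lt_pow_of_log_lt hp ?_)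
      simp at hi; omega
    rw [h1, ← h2, Nat.sub_one_mul_sum_log_div_pow_eq_sub_sum_digits]
    exact Nat.sub_add_cancel (Nat.digit_sum_le _ _)
  have hgeom : (p - 1) * ∑ i ∈ Finset.range f, p ^ i = p ^ f - 1 := by
    rw [Nat.geomSum_eq hp f, Nat.mul_div_cancel' (Nat.sub_one_dvd_pow_sub_one p f)]
  have hsum := Finset.sum_congr rfl fun i hi ↦ hmod i (Finset.mem_range.1 hi)
  rw [Finset.sum_add_distrib, ← Finset.mul_sum, ← Finset.sum_mul] at hsum
  have h3 := congrArg ((p - 1) * ·) hsum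
  simp only [mul_add, ← mul_assoc, hgeom] at h3
  have h4 := congrArg ((p ^ f - 1) * ·) hdiv
  simp only [mul_add] at h4
  nlinarith

lemma Finset.sum_range_mul_eq {M : Type*} [AddCommMonoid M] (g : ℕ → M) (a s : ℕ) :
    ∑ i ∈ range (a * s), g i = ∑ i ∈ range a, ∑ t ∈ range s, g (i + a * t) := by
  rw [Finset.sum_comm]
  induction s with
  | zero => simp
  | succ s ih =>
    rw [Nat.mul_succ, Finset.sum_range_add, ih, Finset.sum_range_succ]
    simp [add_comm]

lemma dvd_of_five_pow_succ_dvd {e d : ℕ} (h : 5 ^ (e + 1) ∣ (3 ^ 12) ^ d - 1) : 5 ^ e ∣ d := by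
  rcases Nat.eq_zero_or_pos d with rfl | hd
  · simp
  have hp : Fact (Nat.Prime 5) := ⟨by norm_num⟩
  have h0 : (3 ^ 12) ^ d - 1 ≠ 0 := by
    have : 1 < (3 ^ 12) ^ d := Nat.one_lt_pow hd.ne' (by norm_num)
    omega
  have h1 := padicValNat.pow_sub_pow (p := 5) (x := 3 ^ 12) (y := 1) (by norm_num) (by norm_num)
    (by norm_num) (by norm_num) hd.ne'
  rw [one_pow] at h1
  have h2 : padicValNat 5 (3 ^ 12 - 1) = 1 := by
    rw [show 3 ^ 12 - 1 = 5 * 106288 by norm_num, padicValNat.mul (by norm_num) (by norm_num),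
      padicValNat.self (by norm_num), padicValNat.eq_zero_of_not_dvd (by norm_num)]
  rw [padicValNat_dvd_iff_le h0, h1, h2] at h
  rw [padicValNat_dvd_iff_le hd.ne']
  omega

lemma sum_mul_pow_mod (e x : ℕ) (hx : ¬ 5 ∣ x) :
    ∑ t ∈ Finset.range (5 ^ e), (x * (3 ^ 12) ^ t % (35 * 5 ^ e)) =
      5 ^ e * (x % 35) + 35 * ∑ z ∈ Finset.range (5 ^ e), z := by
  set g : ℕ → ℕ := fun t ↦ x * (3 ^ 12) ^ t % (35 * 5 ^ e) with hg
  have hpos : 0 < 5 ^ e := by positivity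
  have hmod (t : ℕ) : g t % 35 = x % 35 := by
    rw [hg, Nat.mod_mul_right_mod, Nat.mul_mod, Nat.pow_mod]
    norm_num
  have hlt (t : ℕ) : g t / 35 < 5 ^ e :=
    Nat.div_lt_of_lt_mul (Nat.mod_lt _ (by positivity))
  have hinj : Set.InjOn (fun t ↦ g t / 35) (Finset.range (5 ^ e)) := by
    suffices H : ∀ a b, a ≤ b → b < 5 ^ e → g a / 35 = g b / 35 → a = b by
      intro a ha b hb hab
      rw [Finset.coe_range, Set.mem_Iio] at ha hb
      rcases le_total a b with h | h
      · exact H a b h hb hab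
      · exact (H b a h ha hab.symm).symm
    intro a b hab hb h
    have h1 : g a = g b := by rw [← Nat.div_add_mod (g a) 35, ← Nat.div_add_mod (g b) 35, h,
      hmod, hmod]
    have h2 : x * (3 ^ 12) ^ a ≡ x * (3 ^ 12) ^ b [MOD 35 * 5 ^ e] := h1
    have h3 : x * (3 ^ 12) ^ a ≡ x * (3 ^ 12) ^ b [MOD 5 ^ (e + 1)] :=
      h2.of_dvd ⟨7, by ring⟩
    have h5 : (5 ^ (e + 1)).Coprime x :=
      (Nat.Coprime.pow_left _ ((Nat.Prime.coprime_iff_not_dvd (by norm_num)).2 hx))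
    have h4 := Nat.ModEq.cancel_left_of_coprime h5 h3
    have h6 : (3 ^ 12) ^ a * 1 ≡ (3 ^ 12) ^ a * (3 ^ 12) ^ (b - a) [MOD 5 ^ (e + 1)] := by
      rwa [mul_one, ← pow_add, Nat.add_sub_cancel' hab]
    have h7 := Nat.ModEq.cancel_left_of_coprime (Nat.Coprime.pow_left _
      (Nat.Coprime.pow_right _ (by norm_num))) h6
    have h8 := (Nat.modEq_iff_dvd' (Nat.one_le_pow _ _ (by norm_num))).1 h7
    have := Nat.eq_zero_of_dvd_of_lt (dvd_of_five_pow_succ_dvd h8) (by omega)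
    omega
  have himg : (Finset.range (5 ^ e)).image (fun t ↦ g t / 35) = Finset.range (5 ^ e) := by
    refine Finset.eq_of_subset_of_card_le (fun z hz ↦ ?_) ?_
    · obtain ⟨t, -, rfl⟩ := Finset.mem_image.1 hz
      exact Finset.mem_range.2 (hlt t)
    · rw [Finset.card_image_of_injOn hinj]
  have hz : ∑ z ∈ Finset.range (5 ^ e), z = ∑ t ∈ Finset.range (5 ^ e), g t / 35 := by
    conv_lhs => rw [← himg]
    exact Finset.sum_image hinj
  rw [hz, Finset.mul_sum, show 5 ^ e * (x % 35) = ∑ t ∈ Finset.range (5 ^ e), x % 35 by simp,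
    ← Finset.sum_add_distrib]
  refine Finset.sum_congr rfl fun t _ ↦ ?_
  rw [← hmod t]
  exact (Nat.mod_add_div _ _).symm

lemma le_sum_pow_mul_mod (e j : ℕ) (hj : 5 ∣ j → 5 ^ (e + 1) ∣ j) (hj' : ¬ 35 * 5 ^ e ∣ j) :
    35 * 5 ^ e * (6 * 5 ^ e - 1) ≤
      ∑ i ∈ Finset.range (12 * 5 ^ e), (3 ^ i * j % (35 * 5 ^ e)) := by
  rw [Finset.sum_range_mul_eq]
  have hs : 1 ≤ 5 ^ e := Nat.one_le_pow _ _ (by norm_num)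
  have hcomm (i t : ℕ) : 3 ^ (i + 12 * t) * j = 3 ^ i * j * (3 ^ 12) ^ t := by
    rw [pow_add, pow_mul]; ring
  simp_rw [hcomm]
  by_cases h5 : 5 ∣ j
  · obtain ⟨y, rfl⟩ := hj h5
    have h7 : ¬ 7 ∣ y := fun ⟨z, hz⟩ ↦ hj' ⟨z, by rw [hz]; ring⟩
    have hterm (i t : ℕ) : 3 ^ i * (5 ^ (e + 1) * y) * (3 ^ 12) ^ t % (35 * 5 ^ e) =
        5 ^ (e + 1) * (3 ^ i * (y % 7) % 7) := by
      rw [show 3 ^ i * (5 ^ (e + 1) * y) * (3 ^ 12) ^ t = 5 ^ (e + 1) * (3 ^ i * y * (3 ^ 12) ^ t) by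
        ring, show 35 * 5 ^ e = 5 ^ (e + 1) * 7 by ring, Nat.mul_mod_mul_left]
      congr 1
      rw [Nat.mul_mod, Nat.pow_mod (3 ^ 12)]
      norm_num
    have hdec : ∀ y < 7, y ≠ 0 → ∑ i ∈ Finset.range 12, 3 ^ i * y % 7 = 42 := by decide
    simp_rw [hterm, Finset.sum_const, Finset.card_range, smul_eq_mul, ← Finset.mul_sum]
    rw [hdec _ (Nat.mod_lt _ (by norm_num)) (by omega), pow_succ]
    obtain ⟨s, hs'⟩ : ∃ s, 5 ^ e = s + 1 := ⟨5 ^ e - 1, by omega⟩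
    rw [hs', show 6 * (s + 1) - 1 = 6 * s + 5 by omega]
    nlinarith
  · have hx (i : ℕ) : ¬ 5 ∣ 3 ^ i * j := by
      rw [Nat.Prime.dvd_mul (by norm_num)]
      rintro (h | h)
      · exact absurd (Nat.Prime.dvd_of_dvd_pow (by norm_num) h) (by norm_num)
      · exact h5 h
    simp_rw [fun i ↦ sum_mul_pow_mod e _ (hx i)]
    have hterm (i : ℕ) : 3 ^ i * j % 35 = 3 ^ i * (j % 35) % 35 := by simp
    have hdec : ∀ y < 35, y % 5 ≠ 0 → 175 ≤ ∑ i ∈ Finset.range 12, 3 ^ i * y % 35 := by decide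
    have h := hdec (j % 35) (Nat.mod_lt _ (by norm_num)) (by omega)
    have h2 := Finset.sum_range_id_mul_two (5 ^ e)
    rw [Finset.sum_add_distrib, ← Finset.mul_sum, Finset.sum_const, Finset.card_range]
    simp_rw [hterm, smul_eq_mul]
    set S := ∑ i ∈ Finset.range 12, 3 ^ i * (j % 35) % 35
    set Z := ∑ z ∈ Finset.range (5 ^ e), z
    obtain ⟨s, hs'⟩ : ∃ s, 5 ^ e = s + 1 := ⟨5 ^ e - 1, by omega⟩
    rw [hs'] at h2 ⊢
    rw [show 6 * (s + 1) - 1 = 6 * s + 5 by omega]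
    rw [Nat.add_sub_cancel] at h2
    nlinarith

lemma le_digits_sum {e M : ℕ} (hM : 3 ^ (12 * 5 ^ e) - 1 = 35 * 5 ^ e * M) {j : ℕ}
    (hjN : j < 35 * 5 ^ e) (hj0 : j ≠ 0) (hj : 5 ∣ j → 5 ^ (e + 1) ∣ j) :
    2 * (6 * 5 ^ e - 1) ≤ (Nat.digits 3 (j * M)).sum := by
  have hM0 : 0 < M := by
    rcases Nat.eq_zero_or_pos M with rfl | h
    · have : 1 < 3 ^ (12 * 5 ^ e) := Nat.one_lt_pow (by positivity) (by norm_num)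
      omega
    · exact h
  have h1 := Nat.sub_one_mul_sum_pow_mul_mod (p := 3) (by norm_num) (12 * 5 ^ e) (k := j * M)
    (by rw [hM]; exact Nat.mul_lt_mul_of_pos_right hjN hM0)
  have h2 := le_sum_pow_mul_mod e j hj
    fun h ↦ hj0 (Nat.eq_zero_of_dvd_of_lt h hjN)
  simp_rw [hM, ← mul_assoc, Nat.mul_mod_mul_right, ← Finset.sum_mul] at h1
  have hN : 0 < 35 * 5 ^ e * M := by positivity
  refine Nat.le_of_mul_le_mul_left ?_ hN
  rw [← h1]
  calc _ = 2 * (35 * 5 ^ e * (6 * 5 ^ e - 1)) * M := by ring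
    _ ≤ 2 * (∑ i ∈ Finset.range (12 * 5 ^ e), 3 ^ i * j % (35 * 5 ^ e)) * M :=
      Nat.mul_le_mul_right _ (Nat.mul_le_mul_left _ h2)
    _ = _ := mul_assoc _ _ _

section CharacterSum

variable {F R : Type*} [Field F] [Fintype F] [CommRing R]

/-- The character sum of the additive character `ψ` over the dilate `y • D`. -/
def charSum (ψ : AddChar F R) (D : Finset F) (y : F) : R :=
  ∑ d ∈ D, ψ (y * d)

/-- The number of representations of `x` as a sum of two elements of `D`. -/
def sumCount (D : Finset F) (x : F) : ℕ :=
  ∑ d ∈ D, ∑ d' ∈ D, if d + d' = x then 1 else 0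

variable [IsDomain R] {ψ : AddChar F R}

lemma sum_addChar_mul_neg (hψ : ψ.IsPrimitive) (a x : F) :
    ∑ y, ψ (y * a) * ψ (-(y * x)) = if a = x then (Fintype.card F : R) else 0 := by
  have h := AddChar.sum_mulShift (a - x) hψ
  simp_rw [sub_eq_zero] at h
  push_cast at h
  rw [← h]
  refine Finset.sum_congr rfl fun y _ ↦ ?_
  rw [← AddChar.map_add_eq_mul]
  congr 1
  ring

lemma sum_charSum_mul (hψ : ψ.IsPrimitive) (D : Finset F) (x : F) :
    ∑ y, charSum ψ D y * ψ (-(y * x)) = if x ∈ D then (Fintype.card F : R) else 0 := by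
  simp_rw [charSum, Finset.sum_mul]
  rw [Finset.sum_comm]
  simp_rw [sum_addChar_mul_neg hψ]
  rw [Finset.sum_ite_eq']

lemma sum_charSum_sq_mul (hψ : ψ.IsPrimitive) (D : Finset F) (x : F) :
    ∑ y, charSum ψ D y ^ 2 * ψ (-(y * x)) = Fintype.card F * (sumCount D x : R) := by
  have h (y : F) : charSum ψ D y ^ 2 * ψ (-(y * x)) =
      ∑ d ∈ D, ∑ d' ∈ D, ψ (y * (d + d')) * ψ (-(y * x)) := by
    simp_rw [sq, charSum, Finset.sum_mul_sum, Finset.sum_mul, mul_add, AddChar.map_add_eq_mul]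
  simp_rw [h]
  rw [Finset.sum_comm, sumCount, Nat.cast_sum, Finset.mul_sum]
  refine Finset.sum_congr rfl fun d _ ↦ ?_
  rw [Finset.sum_comm, Nat.cast_sum, Finset.mul_sum]
  refine Finset.sum_congr rfl fun d' _ ↦ ?_
  rw [sum_addChar_mul_neg hψ]
  split_ifs <;> simp

omit [Fintype F] [IsDomain R] in
lemma charSum_zero (D : Finset F) : charSum ψ D 0 = D.card := by
  simp [charSum]

lemma sum_charSum (hψ : ψ.IsPrimitive) {D : Finset F} (hD : 0 ∉ D) :
    ∑ y, charSum ψ D y = 0 := by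
  simpa [hD] using sum_charSum_mul hψ D 0

omit [Fintype F] in
lemma sumCount_zero {D : Finset F} (hD : ∀ x ∈ D, -x ∈ D) : sumCount D 0 = D.card := by
  rw [sumCount, Finset.card_eq_sum_ones]
  refine Finset.sum_congr rfl fun d hd ↦ ?_
  simp_rw [add_eq_zero_iff_neg_eq]
  rw [Finset.sum_ite_eq, if_pos (hD d hd)]

lemma sum_charSum_sq (hψ : ψ.IsPrimitive) {D : Finset F} (hD : ∀ x ∈ D, -x ∈ D) :
    ∑ y, charSum ψ D y ^ 2 = Fintype.card F * (D.card : R) := by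
  simpa [sumCount_zero hD] using sum_charSum_sq_mul hψ D 0

/-- If the nontrivial character sums over `D` satisfy a fixed quadratic equation, then the number of
representations of a nonzero `x` as a sum of two elements of `D` depends only on whether
`x ∈ D`. -/
lemma sumCount_eq_of_quadratic [CharZero R] (hψ : ψ.IsPrimitive) {D : Finset F} {a b c : R}
    (ha : a ≠ 0)
    (h : ∀ y ≠ 0, a * charSum ψ D y ^ 2 + b * charSum ψ D y + c = 0) {x x' : F} (hx : x ≠ 0)
    (hx' : x' ≠ 0) (hxx' : x ∈ D ↔ x' ∈ D) : sumCount D x = sumCount D x' := by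
  have key (z : F) (hz : z ≠ 0) : a * (Fintype.card F * (sumCount D z : R)) =
      a * (D.card : R) ^ 2 + b * D.card + c - b * if z ∈ D then (Fintype.card F : R) else 0 := by
    have h1 := sum_addChar_mul_neg hψ 0 z
    rw [if_neg hz.symm] at h1
    rw [← sum_charSum_sq_mul hψ, ← sum_charSum_mul hψ, eq_sub_iff_add_eq, Finset.mul_sum,
      Finset.mul_sum, ← Finset.sum_add_distrib, ← add_zero (∑ _, _), ← mul_zero c, ← h1,
      Finset.mul_sum, ← Finset.sum_add_distrib, Finset.sum_eq_single 0]
    · simp [charSum_zero]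
    · intro y _ hy
      simp only [mul_zero, AddChar.map_zero_eq_one, one_mul]
      linear_combination ψ (-(y * z)) * h y hy
    · simp
  have h2 := (key x hx).trans ((key x' hx').trans (by simp only [hxx'])).symm
  have hq : (Fintype.card F : R) ≠ 0 := by simp
  exact_mod_cast mul_left_cancel₀ hq (mul_left_cancel₀ ha h2)

end CharacterSum

section CayleyGraph

variable {F : Type*} [Field F] [Fintype F]

omit [Fintype F] in
lemma cayley_adj_iff {D : Set F} (hD : ∀ x ∈ D, -x ∈ D) (h0 : 0 ∉ D) (x y : F) :
    (SimpleGraph.fromRel fun x y : F ↦ x - y ∈ D).Adj x y ↔ x - y ∈ D := by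
  rw [SimpleGraph.fromRel_adj]
  refine ⟨fun ⟨_, h⟩ ↦ h.elim id fun h ↦ by simpa using hD _ h, fun h ↦ ⟨?_, Or.inl h⟩⟩
  rintro rfl
  exact h0 (by simpa using h)

lemma card_commonNeighbors_cayley {D : Set F} (hD : ∀ x ∈ D, -x ∈ D) (h0 : 0 ∉ D) (x y : F) :
    Fintype.card ((SimpleGraph.fromRel fun x y : F ↦ x - y ∈ D).commonNeighbors x y) =
      sumCount D.toFinset (x - y) := by
  rw [sumCount, Finset.sum_comm, ← Set.toFinset_card]
  simp_rw [← eq_sub_iff_add_eq]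
  simp_rw [Finset.sum_ite_eq', ← Finset.card_filter]
  refine Finset.card_bij (fun z _ ↦ z - y) ?_ ?_ ?_
  · intro z hz
    simp only [Set.mem_toFinset, SimpleGraph.mem_commonNeighbors, cayley_adj_iff hD h0] at hz
    simp only [Finset.mem_filter, Set.mem_toFinset, sub_sub_sub_cancel_right]
    exact ⟨by simpa using hD _ hz.2, hz.1⟩
  · intro _ _ _ _ h
    simpa using h
  · intro w hw
    simp only [Finset.mem_filter, Set.mem_toFinset] at hw
    refine ⟨w + y, ?_, by simp⟩
    simp only [Set.mem_toFinset, SimpleGraph.mem_commonNeighbors, cayley_adj_iff hD h0]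
    exact ⟨by simpa [sub_sub, add_comm] using hw.2, by simpa using hD _ hw.1⟩

lemma cayley_isSRGWith {D : Set F} (hD : ∀ x ∈ D, -x ∈ D) (h0 : 0 ∉ D)
    (h : ∀ x x' : F, x ≠ 0 → x' ≠ 0 → (x ∈ D ↔ x' ∈ D) →
      sumCount D.toFinset x = sumCount D.toFinset x')
    {x₁ x₂ : F} (hx₁ : x₁ ∈ D) (hx₂ : x₂ ∉ D) (hx₂0 : x₂ ≠ 0) :
    (SimpleGraph.fromRel fun x y : F ↦ x - y ∈ D).IsSRGWith (Fintype.card F) D.toFinset.card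
      (sumCount D.toFinset x₁) (sumCount D.toFinset x₂) where
  card := rfl
  regular v := by
    rw [← SimpleGraph.card_neighborFinset_eq_degree]
    refine Finset.card_bij (fun z _ ↦ v - z) ?_ ?_ ?_
    · intro z hz
      rw [SimpleGraph.mem_neighborFinset, cayley_adj_iff hD h0] at hz
      exact Set.mem_toFinset.2 hz
    · intro _ _ _ _ h
      simpa using h
    · intro w hw
      refine ⟨v - w, ?_, by simp⟩
      rw [SimpleGraph.mem_neighborFinset, cayley_adj_iff hD h0]
      simpa using hw
  of_adj v w hvw := by
    rw [cayley_adj_iff hD h0] at hvw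
    rw [card_commonNeighbors_cayley hD h0]
    exact h _ _ (fun h ↦ h0 (h ▸ hvw)) (fun h ↦ h0 (h ▸ hx₁)) (iff_of_true hvw hx₁)
  of_not_adj v w hvw hadj := by
    rw [cayley_adj_iff hD h0] at hadj
    rw [card_commonNeighbors_cayley hD h0]
    exact h _ _ (sub_ne_zero.2 hvw) hx₂0 (iff_of_false hadj hx₂)

end CayleyGraph

/-- A family of integers whose first two moments agree with those of a distribution on
`{17 * r, -18 * r}` is two-valued if it satisfies suitable congruences. -/
lemma quadratic_of_moments {ι : Type*} {S : Finset ι} {t : ι → ℤ} {r : ℤ}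
    (hr : 35 ∣ r + 2) (hdvd : ∀ i ∈ S, r ∣ t i) (hmod : ∀ i ∈ S, 35 ∣ t i - 1)
    (h1 : ∑ i ∈ S, t i = 0) (h2 : ∑ i ∈ S, t i ^ 2 = 306 * r ^ 2 * S.card) :
    ∀ i ∈ S, t i ^ 2 + r * t i - 306 * r ^ 2 = 0 := by
  have hsum : ∑ i ∈ S, (t i ^ 2 + r * t i - 306 * r ^ 2) = 0 := by
    rw [Finset.sum_sub_distrib, Finset.sum_add_distrib, ← Finset.mul_sum, h1, h2]
    simp; ring
  refine (Finset.sum_eq_zero_iff_of_nonneg fun i hi ↦ ?_).1 hsum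
  obtain ⟨u, hu⟩ := hdvd i hi
  obtain ⟨a, ha⟩ := hr
  obtain ⟨b, hb⟩ := hmod i hi
  obtain ⟨v, hv⟩ : ∃ v, u = 17 - 35 * v := by
    have : 2 * u + 1 = 35 * (a * u - b) := by
      rw [hu] at hb
      linear_combination u * ha - hb
    generalize a * u - b = c at this
    exact ⟨(17 - u) / 35, by omega⟩
  have hv0 : 0 ≤ v * (v - 1) := by
    rcases le_or_gt v 0 with h | h <;> nlinarith
  have : t i ^ 2 + r * t i - 306 * r ^ 2 = (35 * r) ^ 2 * (v * (v - 1)) := by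
    rw [hu, hv]; ring
  rw [this]
  positivity

section CyclotomicUnion

variable {F : Type*} [Field F] [Fintype F]

/-- The union of the cosets `γ ^ (7 * i + c) • ⟨γ ^ (35 * 5 ^ e)⟩` for `i < 5 ^ e`. -/
def cosetUnion (γ : Fˣ) (e c : ℕ) : Set F :=
  {x | ∃ i < 5 ^ e, ∃ t : ℕ, x = (γ : F) ^ (7 * i + c + 35 * 5 ^ e * t)}

omit [Fintype F] in
lemma zero_notMem_cosetUnion (γ : Fˣ) (e c : ℕ) : 0 ∉ cosetUnion γ e c := by
  rintro ⟨i, -, t, h⟩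
  exact pow_ne_zero _ γ.ne_zero h.symm

variable {γ : Fˣ} {e M : ℕ}

lemma mem_cosetUnion_iff (hγ : orderOf γ = Fintype.card F - 1)
    (hM : Fintype.card F - 1 = 35 * 5 ^ e * M) (c n : ℕ) :
    (γ : F) ^ n ∈ cosetUnion γ e c ↔ ∃ i < 5 ^ e, n ≡ 7 * i + c [MOD 35 * 5 ^ e] := by
  have hpow (a b : ℕ) : (γ : F) ^ a = (γ : F) ^ b ↔ a ≡ b [MOD 35 * 5 ^ e * M] := by
    rw [← hM, ← hγ, ← pow_eq_pow_iff_modEq, Units.ext_iff]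
    simp
  constructor
  · rintro ⟨i, hi, t, h⟩
    refine ⟨i, hi, ((hpow _ _).1 h).of_mul_right _ |>.trans ?_⟩
    simp [Nat.ModEq]
  · rintro ⟨i, hi, h⟩
    refine ⟨i, hi, ?_⟩
    have hpos : 0 < 35 * 5 ^ e * M := by
      rw [← hM]; have := Fintype.one_lt_card (α := F); omega
    have hN : 35 * 5 ^ e ∣ 35 * 5 ^ e * M := dvd_mul_right _ _
    have hle : 7 * i + c ≤ n + 35 * 5 ^ e * M * (7 * i + c) := by nlinarith
    have h' : n ≡ n + 35 * 5 ^ e * M * (7 * i + c) [MOD 35 * 5 ^ e] := by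
      rw [mul_assoc (35 * 5 ^ e), Nat.ModEq, Nat.add_mul_mod_self_left]
    obtain ⟨t, ht⟩ := (Nat.modEq_iff_dvd' hle).1 (h.symm.trans h')
    refine ⟨t, (hpow _ _).2 ?_⟩
    rw [← ht, Nat.add_sub_cancel' hle]
    simp [Nat.ModEq]

lemma neg_mem_cosetUnion (hγ : orderOf γ = Fintype.card F - 1)
    (hM : Fintype.card F - 1 = 35 * 5 ^ e * M) (hodd : Odd (Fintype.card F)) (c : ℕ) {x : F}
    (hx : x ∈ cosetUnion γ e c) : -x ∈ cosetUnion γ e c := by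
  have hM2 : 2 ∣ M := by
    have h : 2 ∣ 35 * 5 ^ e * M := by rw [← hM]; exact (hodd.tsub_odd odd_one).two_dvd
    exact (Nat.Coprime.dvd_mul_left ((Nat.Coprime.mul_right (by norm_num)
      (Nat.Coprime.pow_right _ (by norm_num))))).1 h
  obtain ⟨K, rfl⟩ := hM2
  have hK : 0 < K := by
    rcases Nat.eq_zero_or_pos K with rfl | h
    · have := Fintype.one_lt_card (α := F); simp at hM; omega
    · exact h
  have hneg : (γ : F) ^ (35 * 5 ^ e * K) = -1 := by
    refine (sq_eq_one_iff.1 ?_).resolve_left fun h ↦ ?_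
    · rw [← pow_mul, show 35 * 5 ^ e * K * 2 = orderOf γ by rw [hγ, hM]; ring,
        ← Units.val_pow_eq_pow_val, pow_orderOf_eq_one, Units.val_one]
    · rw [← Units.val_pow_eq_pow_val, Units.val_eq_one] at h
      have := Nat.le_of_dvd (by positivity) (orderOf_dvd_of_pow_eq_one h)
      rw [hγ, hM] at this
      have : 0 < 35 * 5 ^ e * K := by positivity
      nlinarith
  obtain ⟨i, hi, t, rfl⟩ := hx
  refine ⟨i, hi, t + K, ?_⟩
  rw [mul_add, ← add_assoc, pow_add _ _ (35 * 5 ^ e * K), hneg]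
  ring

variable {R : Type*} [CommRing R] [IsDomain R] [Algebra (WittVector 3 F) R]
  [FaithfulSMul (WittVector 3 F) R]

/-- The coefficient of the `j`-th power of a character of order `35 * 5 ^ e` in the indicator
function of `cosetUnion γ e c`. -/
def cosetCoeff (b : R) (e c j : ℕ) : R :=
  ∑ i ∈ Finset.range (5 ^ e), (b ^ (7 * i + c)) ^ j

omit [FaithfulSMul (WittVector 3 F) R] [IsDomain R] [Fintype F] in
lemma invTeichmullerChar_pow_generator (j : ℕ) :
    (invTeichmullerChar 3 F R ^ j) (γ : F) = invTeichmullerChar 3 F R γ ^ j :=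
  MulChar.pow_apply_coe _ _ _

lemma exists_pow_eq_of_orderOf_eq (hγ : orderOf γ = Fintype.card F - 1) (x : Fˣ) :
    ∃ n : ℕ, γ ^ n = x := by
  have h : Subgroup.zpowers γ = ⊤ := by
    apply Subgroup.eq_top_of_card_eq
    rw [Nat.card_zpowers, hγ, Nat.card_eq_fintype_card, Fintype.card_units]
  obtain ⟨n, hn⟩ := mem_powers_iff_mem_zpowers.2 (h ▸ Subgroup.mem_top x)
  exact ⟨n, hn⟩

variable (R) in
omit [IsDomain R] in
lemma isPrimitiveRoot_invTeichmullerChar (hγ : orderOf γ = Fintype.card F - 1) :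
    IsPrimitiveRoot (invTeichmullerChar 3 F R γ) (Fintype.card F - 1) := by
  have := Fintype.one_lt_card (α := F)
  refine IsPrimitiveRoot.mk_of_lt _ (by omega) ?_ fun j h0 hj h ↦ ?_
  · rw [← invTeichmullerChar_pow_generator, MulChar.pow_apply_coe, ← map_pow,
      ← Units.val_pow_eq_pow_val, ← hγ, pow_orderOf_eq_one, Units.val_one, map_one]
  · refine invTeichmullerChar_pow_ne_one (R := R) 3 h0.ne' hj ?_
    ext x
    obtain ⟨n, rfl⟩ := exists_pow_eq_of_orderOf_eq hγ x
    rw [Units.val_pow_eq_pow_val, map_pow, invTeichmullerChar_pow_generator, h, one_pow,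
      ← Units.val_pow_eq_pow_val, MulChar.one_apply_coe]

variable (R) in
omit [IsDomain R] in
lemma exists_isPrimitiveRoot_mul_eq_one (hγ : orderOf γ = Fintype.card F - 1)
    (hM : Fintype.card F - 1 = 35 * 5 ^ e * M) :
    ∃ b : R, IsPrimitiveRoot b (35 * 5 ^ e) ∧ b * invTeichmullerChar 3 F R γ ^ M = 1 := by
  have := Fintype.one_lt_card (α := F)
  have hN : 1 ≤ 35 * 5 ^ e := Nat.succ_le_of_lt (by positivity)
  have h := (isPrimitiveRoot_invTeichmullerChar R hγ).pow (by omega)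
    (hM.trans (mul_comm _ _))
  refine ⟨(invTeichmullerChar 3 F R γ ^ M) ^ (35 * 5 ^ e - 1), h.pow_of_coprime _ ?_, ?_⟩
  · exact ((Nat.coprime_self_sub_right hN).2 (by simp)).symm
  · rw [← pow_succ, Nat.sub_add_cancel hN, h.pow_eq_one]

omit [Algebra (WittVector 3 F) R] [FaithfulSMul (WittVector 3 F) R] in
lemma sum_range_pow_of_pow_eq_one {z : R} {n : ℕ} (hz : z ^ n = 1) :
    ∑ j ∈ Finset.range n, z ^ j = if z = 1 then (n : R) else 0 := by
  split_ifs with h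
  · simp [h]
  · have := geom_sum_mul z n
    rw [hz, sub_self] at this
    exact (mul_eq_zero.1 this).resolve_right (sub_ne_zero.2 h)

omit [IsDomain R] [Algebra (WittVector 3 F) R] [FaithfulSMul (WittVector 3 F) R] in
lemma cosetCoeff_zero (b : R) (e c : ℕ) : cosetCoeff b e c 0 = 5 ^ e := by
  simp [cosetCoeff]

omit [Algebra (WittVector 3 F) R] [FaithfulSMul (WittVector 3 F) R] in
lemma cosetCoeff_eq_zero {b : R} (hb : IsPrimitiveRoot b (35 * 5 ^ e)) (c : ℕ) {j : ℕ}
    (h5 : 5 ∣ j) (hj : ¬ 5 ^ (e + 1) ∣ j) : cosetCoeff b e c j = 0 := by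
  have h (i : ℕ) : (b ^ (7 * i + c)) ^ j = (b ^ (7 * j)) ^ i * b ^ (c * j) := by ring
  simp_rw [cosetCoeff, h]
  rw [← Finset.sum_mul, sum_range_pow_of_pow_eq_one, if_neg, zero_mul]
  · intro h
    have := (hb.pow_eq_one_iff_dvd _).1 h
    rw [show 35 * 5 ^ e = 7 * 5 ^ (e + 1) by ring] at this
    exact hj (Nat.dvd_of_mul_dvd_mul_left (by norm_num) this)
  · obtain ⟨l, rfl⟩ := h5
    rw [← pow_mul, hb.pow_eq_one_iff_dvd]
    exact ⟨l, by ring⟩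

lemma eq_of_modEq {i i' c : ℕ} (hi : i < 5 ^ e) (hi' : i' < 5 ^ e)
    (h : 7 * i + c ≡ 7 * i' + c [MOD 35 * 5 ^ e]) : i = i' := by
  have h1 := Nat.ModEq.add_right_cancel' c h
  rw [show 35 * 5 ^ e = 7 * 5 ^ (e + 1) by ring] at h1
  have h2 := Nat.ModEq.mul_left_cancel' (by norm_num) h1
  rw [pow_succ] at h2
  exact Nat.ModEq.eq_of_lt_of_lt h2 (by omega) (by omega)

omit [FaithfulSMul (WittVector 3 F) R] in
lemma sum_cosetCoeff_mul (hγ : orderOf γ = Fintype.card F - 1)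
    (hM : Fintype.card F - 1 = 35 * 5 ^ e * M) {b : R} (hb : IsPrimitiveRoot b (35 * 5 ^ e))
    (hbγ : b * invTeichmullerChar 3 F R γ ^ M = 1) (c : ℕ) (x : F) :
    ∑ j ∈ Finset.range (35 * 5 ^ e), cosetCoeff b e c j * (invTeichmullerChar 3 F R ^ (j * M)) x =
      if x ∈ cosetUnion γ e c then 35 * 5 ^ e else 0 := by
  rcases eq_or_ne x 0 with rfl | hx
  · rw [if_neg (zero_notMem_cosetUnion _ _ _)]
    exact Finset.sum_eq_zero fun j _ ↦ by rw [MulChar.map_zero, mul_zero]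
  obtain ⟨n, hn⟩ := exists_pow_eq_of_orderOf_eq hγ (Units.mk0 x hx)
  obtain rfl : x = (γ : F) ^ n := by rw [← Units.val_pow_eq_pow_val, hn, Units.val_mk0]
  set β := invTeichmullerChar 3 F R γ ^ M with hβ
  have hχ (j : ℕ) : (invTeichmullerChar 3 F R ^ (j * M)) ((γ : F) ^ n) = (β ^ n) ^ j := by
    rw [map_pow, invTeichmullerChar_pow_generator, hβ]
    ring
  have hz (i : ℕ) : (b ^ (7 * i + c) * β ^ n) ^ (35 * 5 ^ e) = 1 := by
    have hβ1 : β ^ (35 * 5 ^ e) = 1 := by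
      have := congrArg (· ^ (35 * 5 ^ e)) hbγ
      simpa only [mul_pow, hb.pow_eq_one, one_mul, one_pow] using this
    rw [mul_pow, pow_right_comm, hb.pow_eq_one, pow_right_comm β, hβ1, one_pow, one_pow, one_mul]
  have hz1 (i : ℕ) : b ^ (7 * i + c) * β ^ n = 1 ↔ n ≡ 7 * i + c [MOD 35 * 5 ^ e] := by
    have hn1 : b ^ n * β ^ n = 1 := by rw [← mul_pow, hbγ, one_pow]
    have hβ0 : β ^ n ≠ 0 := right_ne_zero_of_mul (hn1 ▸ one_ne_zero)
    have hmod (k : ℕ) : b ^ k = b ^ (k % (35 * 5 ^ e)) := by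
      rw [hb.eq_orderOf, pow_mod_orderOf]
    have hlt (k : ℕ) : k % (35 * 5 ^ e) < 35 * 5 ^ e := Nat.mod_lt _ (by positivity)
    rw [← hn1, mul_left_inj' hβ0, hmod n, hmod (7 * i + c)]
    exact ⟨fun h ↦ (hb.pow_inj (hlt _) (hlt _) h).symm, fun h ↦ by rw [h.symm]⟩
  simp_rw [hχ, cosetCoeff, Finset.sum_mul, ← mul_pow]
  rw [Finset.sum_comm]
  simp_rw [sum_range_pow_of_pow_eq_one (hz _), hz1]
  split_ifs with hmem
  · obtain ⟨i, hi, hni⟩ := (mem_cosetUnion_iff hγ hM c n).1 hmem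
    rw [Finset.sum_eq_single_of_mem i (Finset.mem_range.2 hi), if_pos hni]
    · push_cast; ring
    · intro i' hi' hne
      exact if_neg fun h ↦ hne (eq_of_modEq (Finset.mem_range.1 hi') hi (h.symm.trans hni))
  · exact Finset.sum_eq_zero fun i hi ↦ if_neg fun h ↦ hmem
      ((mem_cosetUnion_iff hγ hM c n).2 ⟨i, Finset.mem_range.1 hi, h⟩)

omit [FaithfulSMul (WittVector 3 F) R] in
lemma sum_cosetUnion (hγ : orderOf γ = Fintype.card F - 1)
    (hM : Fintype.card F - 1 = 35 * 5 ^ e * M) {b : R} (hb : IsPrimitiveRoot b (35 * 5 ^ e))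
    (hbγ : b * invTeichmullerChar 3 F R γ ^ M = 1) (c : ℕ) (f : F → R) :
    35 * 5 ^ e * ∑ x ∈ (cosetUnion γ e c).toFinset, f x = ∑ j ∈ Finset.range (35 * 5 ^ e),
      cosetCoeff b e c j * ∑ x, (invTeichmullerChar 3 F R ^ (j * M)) x * f x := by
  simp_rw [Finset.mul_sum]
  rw [Finset.sum_comm]
  simp_rw [← mul_assoc, ← Finset.sum_mul, sum_cosetCoeff_mul hγ hM hb hbγ]
  simp_rw [ite_mul, zero_mul]
  rw [← Finset.sum_filter]
  refine Finset.sum_congr ?_ fun _ _ ↦ rfl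
  ext
  simp

variable (R) in
lemma card_cosetUnion [CharZero R] (hγ : orderOf γ = Fintype.card F - 1)
    (hM : Fintype.card F - 1 = 35 * 5 ^ e * M) (c : ℕ) :
    35 * (cosetUnion γ e c).toFinset.card = Fintype.card F - 1 := by
  obtain ⟨b, hb, hbγ⟩ := exists_isPrimitiveRoot_mul_eq_one R hγ hM
  have hM0 : M ≠ 0 := by
    rintro rfl
    have := Fintype.one_lt_card (α := F)
    omega
  have h := sum_cosetUnion hγ hM hb hbγ c 1
  simp only [Pi.one_apply, mul_one] at h
  have h5 : 0 < 35 * 5 ^ e := by positivity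
  rw [Finset.sum_eq_single_of_mem 0 (Finset.mem_range.2 h5), cosetCoeff_zero, zero_mul, pow_zero,
    MulChar.sum_one_eq_card_units, Fintype.card_units] at h
  · have h' : 5 ^ e * (35 * (cosetUnion γ e c).toFinset.card) = 5 ^ e * (Fintype.card F - 1) := by
      rw [← Nat.cast_inj (R := R)]
      push_cast
      rw [← h, Finset.sum_const, nsmul_eq_mul, mul_one]
      ring
    exact Nat.eq_of_mul_eq_mul_left (by positivity) h'
  · intro j hj h0
    rw [MulChar.sum_eq_zero_of_ne_one, mul_zero]
    refine invTeichmullerChar_pow_ne_one 3 (mul_ne_zero h0 hM0) ?_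
    rw [hM]
    exact Nat.mul_lt_mul_of_pos_right (Finset.mem_range.1 hj) (Nat.pos_of_ne_zero hM0)

lemma pow_dvd_charSum_cosetUnion [CharP F 3] (hγ : orderOf γ = Fintype.card F - 1)
    (hF : Fintype.card F = 3 ^ (12 * 5 ^ e))
    (hM : Fintype.card F - 1 = 35 * 5 ^ e * M) {ψ : AddChar F R} (hψ0 : ψ ≠ 0) {ϖ : R}
    (hψ : ∀ x, ϖ ∣ ψ x - 1) (hψp : ∀ x, ψ (x ^ 3) = ψ x) (c : ℕ) {y : F} (hy : y ≠ 0) :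
    ϖ ^ (2 * (6 * 5 ^ e - 1)) ∣
      5 ^ e * (35 * charSum ψ (cosetUnion γ e c).toFinset y + 1) := by
  obtain ⟨b, hb, hbγ⟩ := exists_isPrimitiveRoot_mul_eq_one R hγ hM
  have h := sum_cosetUnion hγ hM hb hbγ c fun x ↦ ψ (y * x)
  have h5 : 0 < 35 * 5 ^ e := by positivity
  have hM0 : 0 < M := by
    refine Nat.pos_of_ne_zero ?_
    rintro rfl
    have := Fintype.one_lt_card (α := F)
    omega
  have hF2 : 2 < Fintype.card F := by
    rw [hF]
    exact lt_of_lt_of_le (by norm_num) (Nat.le_self_pow (by positivity) 3)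
  rw [← Finset.add_sum_erase _ _ (Finset.mem_range.2 h5), cosetCoeff_zero, zero_mul, pow_zero] at h
  have h1 : ∑ x, (1 : MulChar F R) x * ψ (y * x) = -1 := by
    have h1' := gaussSum_mulShift (1 : MulChar F R) ψ (Units.mk0 y hy)
    rw [gaussSum_one_left hψ0, MulChar.one_apply_coe, one_mul] at h1'
    exact h1'
  rw [h1] at h
  rw [show 5 ^ e * (35 * charSum ψ (cosetUnion γ e c).toFinset y + 1) =
    35 * 5 ^ e * charSum ψ (cosetUnion γ e c).toFinset y + 5 ^ e by ring, charSum, h,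
    mul_neg_one, neg_add_cancel_comm]
  refine Finset.dvd_sum fun j hj ↦ ?_
  obtain ⟨hj0, hjN⟩ := Finset.mem_erase.1 hj
  rw [Finset.mem_range] at hjN
  by_cases hj5 : 5 ∣ j → 5 ^ (e + 1) ∣ j
  · refine Dvd.dvd.mul_left ?_ _
    have hlt : j * M < Fintype.card F - 1 := by
      rw [hM]
      exact Nat.mul_lt_mul_of_pos_right hjN hM0
    have hg := gaussSum_mulShift (invTeichmullerChar 3 F R ^ (j * M)) ψ (Units.mk0 y hy)
    have hdvd := (pow_dvd_pow ϖ (le_digits_sum (hF ▸ hM) hjN hj0 hj5)).trans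
      (pow_digits_sum_dvd_gaussSum 3 hF2 hψ hψp (j * M) hlt)
    rw [← hg] at hdvd
    exact ((Units.isUnit _).map _).dvd_mul_left.1 hdvd
  · push Not at hj5
    rw [cosetCoeff_eq_zero hb c hj5.1 hj5.2, zero_mul]
    exact dvd_zero _

end CyclotomicUnion

section CubicCharacter

lemma exists_isPrimitive_addChar {F R : Type*} [Field F] [Fintype F] [CharP F 3] [CommRing R]
    [IsDomain R] {ω : R} (hω : IsPrimitiveRoot ω 3) :
    ∃ ψ : AddChar F R, ψ.IsPrimitive ∧ (∀ x, ψ (x ^ 3) = ψ x) ∧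
      ∀ x, ψ x = 1 ∨ ψ x = ω ∨ ψ x = ω ^ 2 := by
  let := ZMod.algebra F 3
  have hfin : Module.Finite (ZMod 3) F := Module.Finite.of_finite
  refine ⟨(AddChar.zmodChar 3 hω.pow_eq_one).compAddMonoidHom
    (Algebra.trace (ZMod 3) F).toAddMonoidHom, AddChar.IsPrimitive.of_ne_one fun h ↦ ?_,
    fun x ↦ ?_, fun x ↦ ?_⟩
  · obtain ⟨x, hx⟩ := Algebra.trace_surjective (ZMod 3) F 1
    have h1 := DFunLike.congr_fun h x
    rw [AddChar.compAddMonoidHom_apply, LinearMap.toAddMonoidHom_coe, hx, AddChar.zmodChar_apply,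
      AddChar.one_apply] at h1
    exact hω.ne_one (by norm_num) (by simpa [ZMod.val_one] using h1)
  · simp only [AddChar.compAddMonoidHom_apply, LinearMap.toAddMonoidHom_coe]
    have h := Algebra.trace_eq_of_algEquiv
      (FiniteField.frobeniusAlgEquivOfAlgebraic (ZMod 3) F) x
    rw [FiniteField.coe_frobeniusAlgEquivOfAlgebraic, ZMod.card] at h
    rw [h]
  · rw [AddChar.compAddMonoidHom_apply, AddChar.zmodChar_apply]
    have := ZMod.val_lt ((Algebra.trace (ZMod 3) F).toAddMonoidHom x)
    interval_cases ZMod.val ((Algebra.trace (ZMod 3) F).toAddMonoidHom x) <;> simp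

variable {F R : Type*} [Field F] [Fintype F] [CommRing R] [IsDomain R] {ω : R}

omit [Fintype F] in
lemma exists_charSum_eq_intCast (hω : IsPrimitiveRoot ω 3) {ψ : AddChar F R}
    (hψ : ∀ x, ψ x = 1 ∨ ψ x = ω ∨ ψ x = ω ^ 2) {D : Finset F} (hD : ∀ x ∈ D, -x ∈ D) (y : F) :
    ∃ n : ℤ, charSum ψ D y = n := by
  have h1 := hω.geom_sum_eq_zero (by norm_num)
  simp only [Finset.sum_range_succ, Finset.sum_range_zero, pow_zero, pow_one, zero_add] at h1
  have h3 := hω.pow_eq_one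
  have hω1 := hω.ne_one (by norm_num)
  have hω0 : ω ≠ 0 := hω.ne_zero (by norm_num)
  have hω2 : ω ^ 2 ≠ 1 := hω.pow_ne_one_of_pos_of_lt (by norm_num) (by norm_num)
  have hω12 : ω ≠ ω ^ 2 := fun h ↦ hω1 (mul_left_cancel₀ hω0 (by linear_combination -h))
  have hterm (x : F) : ψ x = (if ψ x = 1 then 1 else 0) + ω * (if ψ x = ω then 1 else 0) +
      ω ^ 2 * (if ψ x = ω ^ 2 then 1 else 0) := by
    rcases hψ x with h | h | h <;> rw [h] <;>
      simp [hω1, hω1.symm, hω2, hω2.symm, hω12, hω12.symm]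
  have hneg (x : F) : ψ (-x) = ω ^ 2 ↔ ψ x = ω := by
    have h : ψ x * ψ (-x) = 1 := by rw [← AddChar.map_add_eq_mul, add_neg_cancel, ψ.map_zero_eq_one]
    constructor <;> intro h' <;> rw [h'] at h
    · exact mul_right_cancel₀ (pow_ne_zero 2 hω0) (by linear_combination h - h3)
    · exact mul_left_cancel₀ hω0 (by linear_combination h - h3)
  have hsum : ∑ d ∈ D, (if ψ (y * d) = ω ^ 2 then (1 : R) else 0) =
      ∑ d ∈ D, if ψ (y * d) = ω then 1 else 0 := by
    refine Finset.sum_nbij' (-·) (-·) hD hD (by simp) (by simp) fun d _ ↦ ?_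
    simp_rw [← hneg, mul_neg, neg_neg]
  refine ⟨∑ d ∈ D, (if ψ (y * d) = 1 then 1 else 0) - ∑ d ∈ D, if ψ (y * d) = ω then 1 else 0, ?_⟩
  rw [charSum, Finset.sum_congr rfl fun d _ ↦ hterm (y * d), Finset.sum_add_distrib,
    Finset.sum_add_distrib, ← Finset.mul_sum, ← Finset.mul_sum, hsum]
  push_cast
  linear_combination (∑ d ∈ D, if ψ (y * d) = ω then (1 : R) else 0) * h1

end CubicCharacter

/-- If a prime number `p` is not a unit in a domain, then divisibility of integers by powers of `p`
can be checked there. -/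
lemma pow_dvd_of_pow_dvd_intCast {R : Type*} [CommRing R] [IsDomain R] [CharZero R] {p : ℕ}
    (hp : p.Prime) (hpR : ¬ IsUnit (p : R)) {n : ℕ} {a : ℤ} (h : (p : R) ^ n ∣ a) :
    (p : ℤ) ^ n ∣ a := by
  induction n generalizing a with
  | zero => simp
  | succ n ih =>
    have hpa : (p : ℤ) ∣ a := by
      by_contra hpa
      obtain ⟨u, v, huv⟩ := (Nat.prime_iff_prime_int.1 hp).coprime_iff_not_dvd.2 hpa
      refine hpR (isUnit_of_dvd_one ?_)
      have h1 : (p : R) ∣ a := (dvd_pow_self _ n.succ_ne_zero).trans h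
      have h2 := congrArg (Int.cast : ℤ → R) huv
      push_cast at h2
      rw [← h2]
      exact dvd_add (dvd_mul_left _ _) (h1.mul_left _)
    obtain ⟨c, rfl⟩ := hpa
    rw [pow_succ'] at h ⊢
    push_cast at h
    exact mul_dvd_mul_left _ (ih ((mul_dvd_mul_iff_left (Nat.cast_ne_zero.2 hp.ne_zero)).1 h))

lemma WittVector.not_isUnit_natCast (p : ℕ) [Fact p.Prime] (F R : Type*) [Field F] [CharP F p]
    [CommRing R] [Algebra (WittVector p F) R] [FaithfulSMul (WittVector p F) R]
    [Algebra.IsIntegral (WittVector p F) R] : ¬ IsUnit (p : R) := by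
  intro h
  rw [← map_natCast (algebraMap (WittVector p F) R), isUnit_map_iff] at h
  have h1 := h.map (WittVector.constantCoeff (p := p) (R := F))
  rw [map_natCast, CharP.cast_eq_zero] at h1
  exact not_isUnit_zero h1

lemma WittVector.charZero (p : ℕ) [hp : Fact p.Prime] (F : Type*) [Field F] [CharP F p] :
    CharZero (WittVector p F) := by
  obtain ⟨c, hc⟩ := CharP.exists (WittVector p F)
  rcases CharP.char_is_prime_or_zero (WittVector p F) c with h | rfl
  · have h0 : (c : F) = 0 := by
      rw [← map_natCast (WittVector.constantCoeff (p := p) (R := F)), CharP.cast_eq_zero, map_zero]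
    obtain rfl := (Nat.prime_dvd_prime_iff_eq hp.out h).1 ((CharP.cast_eq_zero_iff F p c).1 h0)
    exact absurd (CharP.cast_eq_zero _ _) (WittVector.p_nonzero p F)
  · exact CharP.charP_to_charZero _

section Numerics

variable (e : ℕ)

lemma dvd_three_pow_sub_one : 35 * 5 ^ e ∣ 3 ^ (12 * 5 ^ e) - 1 := by
  have h5 : 5 ^ (e + 1) ∣ 3 ^ (12 * 5 ^ e) - 1 := by
    refine (Nat.modEq_iff_dvd' (Nat.one_le_pow _ _ (by norm_num))).1 ?_
    have h := (Nat.ModEq.pow_totient (x := 3) (n := 5 ^ (e + 1))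
      (Nat.Coprime.pow_right _ (by norm_num))).pow 3
    rw [Nat.totient_prime_pow_succ (by norm_num), ← pow_mul, one_pow,
      show 5 ^ e * (5 - 1) * 3 = 12 * 5 ^ e by ring] at h
    exact h.symm
  have h7 : 7 ∣ 3 ^ (12 * 5 ^ e) - 1 := by
    refine (Nat.modEq_iff_dvd' (Nat.one_le_pow _ _ (by norm_num))).1 ?_
    have h : 3 ^ 12 ≡ 1 [MOD 7] := by decide
    simpa [pow_mul] using (h.pow (5 ^ e)).symm
  rw [show 35 * 5 ^ e = 7 * 5 ^ (e + 1) by ring]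
  exact Nat.Coprime.mul_dvd_of_dvd_of_dvd (Nat.Coprime.pow_right _ (by norm_num)) h7 h5

lemma three_pow_eq_nine_mul_sq : 3 ^ (12 * 5 ^ e) = 9 * (3 ^ (6 * 5 ^ e - 1)) ^ 2 := by
  have : 0 < 5 ^ e := by positivity
  rw [show 12 * 5 ^ e = 2 + (6 * 5 ^ e - 1) * 2 by omega, pow_add, pow_mul]
  norm_num

lemma dvd_three_pow_add_two : (35 : ℤ) ∣ 3 ^ (6 * 5 ^ e - 1) + 2 := by
  have h0 : 0 < 5 ^ e := by positivity
  obtain ⟨k, hk⟩ : Odd (5 ^ e) := Odd.pow (by decide)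
  have h : (3 : ℤ) ^ (6 * 5 ^ e) ≡ 29 [ZMOD 35] := by
    have h12 : (3 : ℤ) ^ 12 ≡ 1 [ZMOD 35] := by decide
    have h6 : (3 : ℤ) ^ 6 ≡ 29 [ZMOD 35] := by decide
    rw [hk, show 6 * (2 * k + 1) = 12 * k + 6 by ring, pow_add, pow_mul]
    simpa using (h12.pow k).mul h6
  rw [show 6 * 5 ^ e = (6 * 5 ^ e - 1) + 1 by omega, pow_succ] at h
  have h' := h.dvd
  generalize (3 : ℤ) ^ (6 * 5 ^ e - 1) = r at h' ⊢
  omega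

end Numerics

section StronglyRegular

variable {F : Type*} [Field F] [Fintype F] {γ : Fˣ} {e : ℕ}

lemma charSum_cosetUnion_quadratic [CharP F 3] {R : Type*} [CommRing R] [IsDomain R] [CharZero R]
    [Algebra (WittVector 3 F) R] [FaithfulSMul (WittVector 3 F) R]
    [Algebra.IsIntegral (WittVector 3 F) R] (hF : Fintype.card F = 3 ^ (12 * 5 ^ e))
    (hγ : orderOf γ = Fintype.card F - 1) (c : ℕ) {ω : R} (hω : IsPrimitiveRoot ω 3)
    {ψ : AddChar F R} (hψ : ψ.IsPrimitive) (hψp : ∀ x, ψ (x ^ 3) = ψ x)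
    (hψω : ∀ x, ψ x = 1 ∨ ψ x = ω ∨ ψ x = ω ^ 2) {y : F} (hy : y ≠ 0) :
    1225 * charSum ψ (cosetUnion γ e c).toFinset y ^ 2 +
      (70 + 35 * 3 ^ (6 * 5 ^ e - 1)) * charSum ψ (cosetUnion γ e c).toFinset y +
      (1 + 3 ^ (6 * 5 ^ e - 1) - 306 * (3 ^ (6 * 5 ^ e - 1)) ^ 2) = 0 := by
  obtain ⟨M, hM⟩ := dvd_three_pow_sub_one e
  rw [← hF] at hM
  set D := (cosetUnion γ e c).toFinset with hD
  set n := 6 * 5 ^ e - 1 with hn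
  have hodd : Odd (Fintype.card F) := by rw [hF]; exact Odd.pow (by decide)
  have hDneg : ∀ x ∈ D, -x ∈ D := fun x hx ↦ by
    rw [hD, Set.mem_toFinset] at hx ⊢
    exact neg_mem_cosetUnion hγ hM hodd c hx
  have hD0 : 0 ∉ D := by rw [hD, Set.mem_toFinset]; exact zero_notMem_cosetUnion γ e c
  have hcard : 35 * (D.card : ℤ) = Fintype.card F - 1 := by
    have h := card_cosetUnion R hγ hM c
    have := Fintype.card_pos (α := F)
    rw [← hD] at h
    omega
  have hq : (Fintype.card F : ℤ) = 9 * (3 ^ n) ^ 2 := by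
    rw [hF, three_pow_eq_nine_mul_sq]; push_cast; rfl
  choose θ hθ using exists_charSum_eq_intCast hω hψω hDneg
  have hω2 := hω.geom_sum_eq_zero (by norm_num)
  simp only [Finset.sum_range_succ, Finset.sum_range_zero, pow_zero, pow_one, zero_add] at hω2
  have hdvd : ∀ y ≠ 0, (3 : ℤ) ^ n ∣ 35 * θ y + 1 := by
    intro y hy
    have hψ1 : ψ ≠ 1 := by simpa using hψ one_ne_zero
    have h := pow_dvd_charSum_cosetUnion hγ hF hM hψ1 (ϖ := ω - 1) (fun x ↦ by
      rcases hψω x with h | h | h <;> rw [h]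
      · simp
      · exact sub_one_dvd_pow_sub_one _ _) hψp c hy
    have hω3 : (ω - 1) ^ 2 = 3 * -ω := by linear_combination hω2
    rw [pow_mul, hω3, mul_pow, ← hD, hθ y] at h
    have h' := pow_dvd_of_pow_dvd_intCast Nat.prime_three (R := R)
      (by simpa using WittVector.not_isUnit_natCast 3 F R) (n := n) (a := 5 ^ e * (35 * θ y + 1))
      (by push_cast; exact (dvd_mul_right _ _).trans h)
    exact (IsCoprime.pow (by norm_num)).dvd_of_dvd_mul_left h'
  have hsum : ∑ y, θ y = 0 := by
    rw [← Int.cast_inj (α := R)]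
    push_cast
    simp_rw [← hθ]
    exact sum_charSum hψ hD0
  have hsq : ∑ y, θ y ^ 2 = Fintype.card F * D.card := by
    rw [← Int.cast_inj (α := R)]
    push_cast
    simp_rw [← hθ]
    exact sum_charSum_sq hψ hDneg
  have hθ0 : θ 0 = D.card := by
    rw [← Int.cast_inj (α := R), ← hθ, charSum_zero]
    simp
  have herase (f : F → ℤ) : ∑ y ∈ Finset.univ.erase 0, f y = ∑ y, f y - f 0 := by
    rw [← Finset.add_sum_erase _ _ (Finset.mem_univ 0), add_sub_cancel_left]
  have key := quadratic_of_moments (S := Finset.univ.erase (0 : F)) (t := fun y ↦ 35 * θ y + 1)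
    (dvd_three_pow_add_two e) (fun y hy ↦ hdvd y (Finset.ne_of_mem_erase hy)) (by simp) ?_ ?_ y
    (by simpa using hy)
  · rw [hθ y]
    have key' := congrArg (Int.cast : ℤ → R) key
    push_cast at key'
    linear_combination key'
  · rw [herase, Finset.sum_add_distrib, ← Finset.mul_sum, hsum, hθ0, Finset.sum_const,
      Finset.card_univ, nsmul_eq_mul]
    linear_combination -hcard
  · have h (y : F) : (35 * θ y + 1) ^ 2 = 1225 * θ y ^ 2 + 70 * θ y + 1 := by ring
    simp_rw [h]
    rw [herase, Finset.sum_add_distrib, Finset.sum_add_distrib, ← Finset.mul_sum, ← Finset.mul_sum,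
      hsum, hsq, hθ0, Finset.sum_const, Finset.card_univ, nsmul_eq_mul,
      Finset.card_erase_of_mem (Finset.mem_univ _), Finset.card_univ,
      Nat.cast_sub Fintype.card_pos]
    simp only [← hn]
    push_cast
    generalize (Fintype.card F : ℤ) = q at *
    generalize (3 : ℤ) ^ n = r at *
    generalize (D.card : ℤ) = d at *
    linear_combination (35 * q - 35 * d - 1 - q) * hcard + 34 * (q - 1) * hq

lemma exists_sumCount_cosetUnion_eq [CharP F 3] (hF : Fintype.card F = 3 ^ (12 * 5 ^ e))
    (hγ : orderOf γ = Fintype.card F - 1) (c : ℕ) :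
    35 * (cosetUnion γ e c).toFinset.card = Fintype.card F - 1 ∧
      ∀ x x' : F, x ≠ 0 → x' ≠ 0 → (x ∈ cosetUnion γ e c ↔ x' ∈ cosetUnion γ e c) →
        sumCount (cosetUnion γ e c).toFinset x = sumCount (cosetUnion γ e c).toFinset x' := by
  let W := WittVector 3 F
  let K := AlgebraicClosure (FractionRing W)
  let R := integralClosure W K
  have hWK : Function.Injective (algebraMap W K) := by
    rw [IsScalarTower.algebraMap_eq W (FractionRing W) K]
    exact (algebraMap (FractionRing W) K).injective.comp (IsFractionRing.injective W _)
  have : FaithfulSMul W K := (faithfulSMul_iff_algebraMap_injective W K).2 hWK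
  have : FaithfulSMul W R := (faithfulSMul_iff_algebraMap_injective W R).2 fun a b h ↦
    hWK (congrArg Subtype.val h)
  have : CharZero W := WittVector.charZero 3 F
  have : CharZero K := charZero_of_injective_algebraMap hWK
  have : CharZero R := charZero_of_injective_algebraMap
    (FaithfulSMul.algebraMap_injective W R)
  have : Algebra.IsIntegral W R := inferInstance
  obtain ⟨ω, hω⟩ : ∃ ω : R, IsPrimitiveRoot ω 3 := by
    have : NeZero ((3 : ℕ) : K) := ⟨by norm_num⟩
    obtain ⟨ω, hω⟩ := HasEnoughRootsOfUnity.exists_primitiveRoot K 3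
    have hint : IsIntegral W ω := IsIntegral.of_pow (n := 3) (by norm_num)
      (by rw [hω.pow_eq_one]; exact isIntegral_one)
    exact ⟨⟨ω, hint⟩, hω.of_map_of_injective (f := R.val) Subtype.val_injective⟩
  obtain ⟨ψ, hψ, hψp, hψω⟩ := exists_isPrimitive_addChar (F := F) hω
  obtain ⟨M, hM⟩ := dvd_three_pow_sub_one e
  rw [← hF] at hM
  refine ⟨card_cosetUnion R hγ hM c, fun x x' hx hx' h ↦ ?_⟩
  exact sumCount_eq_of_quadratic hψ (a := 1225) (by norm_num)
    (fun y hy ↦ charSum_cosetUnion_quadratic hF hγ c hω hψ hψp hψω hy) hx hx' (by simpa using h)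

end StronglyRegular

/-- Each `Cay(F_q, D_k)` is a strongly regular graph of degree `(q-1)/35`,
where `q = 3^{12*5^(m-1)}`, `N = 5^m*7`. -/
theorem cayley_srg_example_10
    (m N q : ℕ) (hm : 1 ≤ m)
    (hN : N = 5 ^ m * 7) (hq : q = 3 ^ (12 * 5 ^ (m - 1)))
    (F : Type) [Field F] [Fintype F] (hF : Fintype.card F = q)
    (γ : Fˣ) (hγ : orderOf γ = q - 1)
    (D : ℕ → Set F)
    (hD : ∀ k, D k = {x : F | ∃ i < 5 ^ (m - 1), ∃ t : ℕ,
        x = ((γ : F)) ^ (7 * i + k * 5 ^ (m - 1) + N * t)}) :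
    ∀ k ≤ 34,
      SimpleGraph.fromRel (fun x y : F => x - y ∈ D k) ≠ ⊤ ∧
      SimpleGraph.fromRel (fun x y : F => x - y ∈ D k) ≠ ⊥ ∧
      ∃ l u : ℕ, (SimpleGraph.fromRel (fun x y : F => x - y ∈ D k)).IsSRGWith
        q ((q - 1) / 35) l u := by
  obtain ⟨e, rfl⟩ := Nat.exists_eq_add_of_le' hm
  simp only [Nat.add_sub_cancel] at hq hD
  subst hF
  have : Fact (Nat.Prime 3) := ⟨Nat.prime_three⟩
  have hchar : CharP F 3 := charP_of_card_eq_prime_pow hq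
  intro k _
  obtain rfl : N = 35 * 5 ^ e := by rw [hN]; ring
  have hDk : D k = cosetUnion γ e (k * 5 ^ e) := hD k
  rw [hDk]
  obtain ⟨hcard, hcount⟩ := exists_sumCount_cosetUnion_eq hq hγ (k * 5 ^ e)
  obtain ⟨M, hM⟩ := dvd_three_pow_sub_one e
  rw [← hq] at hM
  have hodd : Odd (Fintype.card F) := by rw [hq]; exact Odd.pow (by decide)
  have hneg : ∀ x ∈ cosetUnion γ e (k * 5 ^ e), -x ∈ cosetUnion γ e (k * 5 ^ e) :=
    fun x hx ↦ neg_mem_cosetUnion hγ hM hodd _ hx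
  have h0 := zero_notMem_cosetUnion γ e (k * 5 ^ e)
  have hF1 := Fintype.one_lt_card (α := F)
  obtain ⟨x₁, hx₁⟩ : ∃ x, x ∈ (cosetUnion γ e (k * 5 ^ e)).toFinset :=
    Finset.card_pos.1 (by omega)
  obtain ⟨x₂, hx₂, hx₂'⟩ : ∃ x ∈ Finset.univ.erase 0,
      x ∉ (cosetUnion γ e (k * 5 ^ e)).toFinset :=
    Finset.exists_mem_notMem_of_card_lt_card (by
      rw [Finset.card_erase_of_mem (Finset.mem_univ _), Finset.card_univ]; omega)
  have hx₂0 := Finset.ne_of_mem_erase hx₂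
  rw [Set.mem_toFinset] at hx₁ hx₂'
  have hadj := cayley_adj_iff hneg h0
  have hdeg : (Fintype.card F - 1) / 35 = (cosetUnion γ e (k * 5 ^ e)).toFinset.card := by omega
  rw [hdeg]
  refine ⟨fun h ↦ hx₂' ?_, fun h ↦ ?_, _, _, cayley_isSRGWith hneg h0 hcount hx₁ hx₂' hx₂0⟩
  · simpa [h, hx₂0] using hadj x₂ 0
  · simpa [h, hx₁] using hadj x₁ 0
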